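/- Fix p_A ∈ [0, 1/2]. The binary key-leakage-storage region of the generated-secret model, namely the subset of ℝ³ given by ℛ_{gs,bin} = ⋃_{q ∈ [0, 1/2]} { (R_s, R_ℓ, R_w) : 0 ≤ R_s ≤ 1 − H_b(q ∗ p_A), R_ℓ ≥ H_b(q ∗ p_A) − H_b(q), R_w ≥ H_b(q ∗ p_A) − H_b(q) }, is a convex subset of ℝ³. -/

import Mathlib

/-- The binary entropy function `H_b(p) = −p log₂ p − (1 − p) log₂(1 − p)`
(with the convention `H_b(0) = H_b(1) = 0`, automatic since `Real.logb 2 0 = 0`). -/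
noncomputable def binEnt (p : ℝ) : ℝ := -(p * Real.logb 2 p) - (1 - p) * Real.logb 2 (1 - p)

/-- The star operation `q ∗ p = q(1 − p) + (1 − q)p`. -/
def starOp (q p : ℝ) : ℝ := q * (1 - p) + (1 - q) * p

/-- The binary key-leakage-storage region `ℛ_{gs,bin}` of the generated-secret model:
triples `(R_s, R_ℓ, R_w)` such that for some `q ∈ [0, 1/2]`,
`0 ≤ R_s ≤ 1 − H_b(q ∗ p_A)`, `R_ℓ ≥ H_b(q ∗ p_A) − H_b(q)`, and
`R_w ≥ H_b(q ∗ p_A) − H_b(q)`. -/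
def RgsBin (pA : ℝ) : Set (ℝ × ℝ × ℝ) :=
  ⋃ q ∈ Set.Icc (0 : ℝ) (1 / 2),
    {v : ℝ × ℝ × ℝ |
      0 ≤ v.1 ∧ v.1 ≤ 1 - binEnt (starOp q pA) ∧
      binEnt (starOp q pA) - binEnt q ≤ v.2.1 ∧
      binEnt (starOp q pA) - binEnt q ≤ v.2.2}

open Real Set in
lemma hasDerivAt_artanh {t : ℝ} (ht : t ∈ Ioo (-1) 1) :
    HasDerivAt artanh (1 / (1 - t ^ 2)) t := by
  have h := hasDerivAt_half_log_one_add_div_one_sub_sub_sum_range 0 ht.1 ht.2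
  simp only [Finset.range_zero, Finset.sum_empty, sub_zero, pow_zero] at h
  refine h.congr_of_eventuallyEq ?_
  filter_upwards [Ioo_mem_nhds ht.1 ht.2] with u hu
  exact artanh_eq_half_log (Ioo_subset_Icc_self hu)

open Real Set in
lemma le_artanh {t : ℝ} (ht₀ : 0 ≤ t) (ht₁ : t < 1) : t ≤ artanh t := by
  rw [artanh_eq_half_log ⟨by linarith, ht₁.le⟩]
  simpa using sum_range_le_log_div ht₀ ht₁ 1

open Real Set in
lemma antitoneOn_one_sub_sq_mul_artanh_div :
    AntitoneOn (fun t ↦ (1 - t ^ 2) * artanh t / t) (Ioo 0 1) := by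
  have hd : ∀ t ∈ Ioo (0 : ℝ) 1, HasDerivAt (fun t ↦ (1 - t ^ 2) * artanh t / t)
      ((t - (1 + t ^ 2) * artanh t) / t ^ 2) t := by
    intro t ht
    have h := ((((hasDerivAt_id t).pow 2).const_sub 1).mul
      (hasDerivAt_artanh ⟨by linarith [ht.1], ht.2⟩)).div (hasDerivAt_id t) ht.1.ne'
    refine h.congr_deriv ?_
    have h₁ : 1 - t ^ 2 ≠ 0 := by nlinarith [ht.1, ht.2]
    have h₂ : t ≠ 0 := ht.1.ne'
    simp
    field_simp
    ring
  refine antitoneOn_of_deriv_nonpos (convex_Ioo 0 1)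
    (fun t ht ↦ (hd t ht).continuousAt.continuousWithinAt) ?_ ?_
  · rw [interior_Ioo]
    exact fun t ht ↦ (hd t ht).differentiableAt.differentiableWithinAt
  · rw [interior_Ioo]
    intro t ht
    rw [(hd t ht).deriv]
    refine div_nonpos_of_nonpos_of_nonneg ?_ (sq_nonneg t)
    nlinarith [le_artanh ht.1.le ht.2, ht.1, sq_nonneg t]

open Real Set in
/-- Scaling the argument of `artanh` by `c ∈ (0, 1]` yields a ratio decreasing in the argument. -/
lemma antitoneOn_artanh_mul_div_artanh {c : ℝ} (hc₀ : 0 < c) (hc₁ : c ≤ 1) :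
    AntitoneOn (fun t ↦ artanh (c * t) / artanh t) (Ioo 0 1) := by
  have hct : ∀ t ∈ Ioo (0 : ℝ) 1, c * t ∈ Ioo (0 : ℝ) 1 ∧ c * t ≤ t := fun t ht ↦
    ⟨⟨mul_pos hc₀ ht.1, by nlinarith [ht.1, ht.2]⟩, by nlinarith [ht.1]⟩
  have hd : ∀ t ∈ Ioo (0 : ℝ) 1, HasDerivAt (fun t ↦ artanh (c * t) / artanh t)
      ((c / (1 - (c * t) ^ 2) * artanh t - artanh (c * t) * (1 / (1 - t ^ 2)))
        / artanh t ^ 2) t := by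
    intro t ht
    have h₁ : HasDerivAt (fun t ↦ artanh (c * t)) (1 / (1 - (c * t) ^ 2) * (c * 1)) t :=
      (hasDerivAt_artanh ⟨by linarith [(hct t ht).1.1], (hct t ht).1.2⟩).comp t
        ((hasDerivAt_id t).const_mul c)
    have h := h₁.div (hasDerivAt_artanh ⟨by linarith [ht.1], ht.2⟩) (artanh_pos ht).ne'
    refine h.congr_deriv ?_
    ring
  refine antitoneOn_of_deriv_nonpos (convex_Ioo 0 1)
    (fun t ht ↦ (hd t ht).continuousAt.continuousWithinAt) ?_ ?_
  · rw [interior_Ioo]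
    exact fun t ht ↦ (hd t ht).differentiableAt.differentiableWithinAt
  · rw [interior_Ioo]
    intro t ht
    rw [(hd t ht).deriv]
    refine div_nonpos_of_nonpos_of_nonneg ?_ (sq_nonneg _)
    obtain ⟨hs, hle⟩ := hct t ht
    have h := antitoneOn_one_sub_sq_mul_artanh_div hs ht hle
    have h₁ : 0 < 1 - t ^ 2 := by nlinarith [ht.1, ht.2]
    have h₂ : 0 < 1 - (c * t) ^ 2 := by nlinarith [hs.1, hs.2]
    simp only at h
    rw [div_le_div_iff₀ ht.1 hs.1] at h
    have h₃ : c * artanh t * (1 - t ^ 2) ≤ artanh (c * t) * (1 - (c * t) ^ 2) := by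
      refine le_of_mul_le_mul_right ?_ ht.1
      linarith
    rw [sub_nonpos, div_mul_eq_mul_div, mul_one_div, div_le_div_iff₀ h₂ h₁]
    exact h₃

open Real Set in
lemma hasDerivAt_binEntropy_one_sub_div_two {t : ℝ} (ht : t ∈ Ioo (-1) 1) :
    HasDerivAt (fun t ↦ binEntropy ((1 - t) / 2)) (-artanh t) t := by
  have h₁ : HasDerivAt (fun t : ℝ ↦ (1 - t) / 2) (-1 / 2) t :=
    ((hasDerivAt_id t).const_sub 1).div_const 2
  have h := (hasDerivAt_binEntropy (p := (1 - t) / 2) (by linarith [ht.2])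
    (by linarith [ht.1])).comp t h₁
  refine h.congr_deriv ?_
  have hp : 0 < 1 + t := by linarith [ht.1]
  have hm : 0 < 1 - t := by linarith [ht.2]
  rw [artanh_eq_half_log (Ioo_subset_Icc_self ht), log_div hp.ne' hm.ne',
    show 1 - (1 - t) / 2 = (1 + t) / 2 by ring, log_div hp.ne' two_ne_zero,
    log_div hm.ne' two_ne_zero]
  ring

open Real Set in
/-- The graph of `binEntropy ((1 - c * t) / 2)` as a function of `binEntropy ((1 - t) / 2)`
lies above its tangent line at every interior point. -/
lemma binEntropy_tangent_le {c s t : ℝ} (hc₀ : 0 < c) (hc₁ : c ≤ 1) (ht : t ∈ Ioo 0 1)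
    (hs : s ∈ Icc 0 1) :
    binEntropy ((1 - c * t) / 2)
        - c * (artanh (c * t) / artanh t) * binEntropy ((1 - t) / 2)
      ≤ binEntropy ((1 - c * s) / 2)
        - c * (artanh (c * t) / artanh t) * binEntropy ((1 - s) / 2) := by
  set m := artanh (c * t) / artanh t with hm
  let G : ℝ → ℝ := fun u ↦ binEntropy ((1 - c * u) / 2) - c * m * binEntropy ((1 - u) / 2)
  have hG : Continuous G := by fun_prop
  have hd : ∀ u ∈ Ioo (0 : ℝ) 1,
      HasDerivAt G (c * artanh u * (m - artanh (c * u) / artanh u)) u := by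
    intro u hu
    have h₁ : HasDerivAt (fun u ↦ binEntropy ((1 - c * u) / 2)) (-artanh (c * u) * (c * 1)) u :=
      (hasDerivAt_binEntropy_one_sub_div_two (t := c * u)
        ⟨by nlinarith [hu.1], by nlinarith [hu.1, hu.2]⟩).comp u ((hasDerivAt_id u).const_mul c)
    have h := h₁.sub ((hasDerivAt_binEntropy_one_sub_div_two (t := u)
      ⟨by linarith [hu.1], hu.2⟩).const_mul (c * m))
    refine h.congr_deriv ?_
    have := (artanh_pos hu).ne'
    field_simp
    ring
  have hr := antitoneOn_artanh_mul_div_artanh hc₀ hc₁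
  change G t ≤ G s
  rcases le_total s t with hst | hst
  · refine antitoneOn_of_deriv_nonpos (convex_Icc 0 t) hG.continuousOn ?_ ?_
      ⟨hs.1, hst⟩ ⟨ht.1.le, le_rfl⟩ hst
    all_goals rw [interior_Icc]; intro u hu
    all_goals have hu' : u ∈ Ioo (0 : ℝ) 1 := ⟨hu.1, hu.2.trans ht.2⟩
    · exact (hd u hu').differentiableAt.differentiableWithinAt
    · rw [(hd u hu').deriv]
      exact mul_nonpos_of_nonneg_of_nonpos (mul_pos hc₀ (artanh_pos hu')).le
        (sub_nonpos.2 (hr hu' ht hu.2.le))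
  · refine monotoneOn_of_deriv_nonneg (convex_Icc t 1) hG.continuousOn ?_ ?_
      ⟨le_rfl, ht.2.le⟩ ⟨hst, hs.2⟩ hst
    all_goals rw [interior_Icc]; intro u hu
    all_goals have hu' : u ∈ Ioo (0 : ℝ) 1 := ⟨ht.1.trans hu.1, hu.2⟩
    · exact (hd u hu').differentiableAt.differentiableWithinAt
    · rw [(hd u hu').deriv]
      exact mul_nonneg (mul_pos hc₀ (artanh_pos hu')).le
        (sub_nonneg.2 (hr ht hu' hu.1.le))

open Real Set in
/-- **Mrs. Gerber's lemma**: `binEntropy ((1 - c * t) / 2)` is a convex function of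
`binEntropy ((1 - t) / 2)`. -/
lemma mrs_gerber {c x y t a b : ℝ} (hc : c ∈ Icc 0 1) (hx : x ∈ Icc 0 1) (hy : y ∈ Icc 0 1)
    (ht : t ∈ Icc 0 1) (ha : 0 < a) (hb : 0 < b) (hab : a + b = 1)
    (h : binEntropy ((1 - t) / 2) =
      a * binEntropy ((1 - x) / 2) + b * binEntropy ((1 - y) / 2)) :
    binEntropy ((1 - c * t) / 2) ≤
      a * binEntropy ((1 - c * x) / 2) + b * binEntropy ((1 - c * y) / 2) := by
  obtain rfl | hc₀ := hc.1.eq_or_lt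
  · simp only [zero_mul]
    rw [← add_mul, hab, one_mul]
  obtain rfl | ht₀ := ht.1.eq_or_lt
  · have key : ∀ u, binEntropy ((1 - u) / 2) = log 2 → u = 0 := fun u hu ↦ by
      linarith [binEntropy_eq_log_two.1 hu]
    have h₀ : binEntropy ((1 - (0 : ℝ)) / 2) = log 2 := binEntropy_eq_log_two.2 (by norm_num)
    have h₁ := binEntropy_le_log_two (p := (1 - x) / 2)
    have h₂ := binEntropy_le_log_two (p := (1 - y) / 2)
    have h₃ : log 2 = a * log 2 + b * log 2 := by rw [← add_mul, hab, one_mul]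
    rw [h₀] at h
    obtain rfl : x = 0 := key x (h₁.antisymm (le_of_mul_le_mul_left (by nlinarith) ha))
    obtain rfl : y = 0 := key y (h₂.antisymm (le_of_mul_le_mul_left (by nlinarith) hb))
    rw [← add_mul, hab, one_mul]
  obtain rfl | ht₁ := ht.2.eq_or_lt
  · have mono : ∀ u ∈ Icc (0 : ℝ) 1,
        binEntropy ((1 - c * 1) / 2) ≤ binEntropy ((1 - c * u) / 2) := fun u hu ↦
      binEntropy_strictMonoOn.monotoneOn ⟨by linarith [hc.2], by linarith⟩
        ⟨by nlinarith [hc.2, hu.1, hu.2], by nlinarith [hu.1]⟩ (by nlinarith [hu.2])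
    have h₃ := add_le_add (mul_le_mul_of_nonneg_left (mono x hx) ha.le)
      (mul_le_mul_of_nonneg_left (mono y hy) hb.le)
    rwa [← add_mul, hab, one_mul] at h₃
  have h₁ := binEntropy_tangent_le hc₀ hc.2 ⟨ht₀, ht₁⟩ hx
  have h₂ := binEntropy_tangent_le hc₀ hc.2 ⟨ht₀, ht₁⟩ hy
  have h₃ := add_le_add (mul_le_mul_of_nonneg_left h₁ ha.le) (mul_le_mul_of_nonneg_left h₂ hb.le)
  rw [← add_mul, hab, one_mul, h] at h₃
  linarith

lemma binEnt_eq_binEntropy_div (p : ℝ) : binEnt p = Real.binEntropy p / Real.log 2 := by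
  simp only [binEnt, Real.logb, Real.binEntropy, Real.log_inv]
  ring

open Real Set in
lemma binEnt_starOp_le {p q q₁ q₂ a b : ℝ} (hp : p ∈ Icc 0 (1 / 2)) (hq : q ∈ Icc 0 (1 / 2))
    (hq₁ : q₁ ∈ Icc 0 (1 / 2)) (hq₂ : q₂ ∈ Icc 0 (1 / 2)) (ha : 0 < a) (hb : 0 < b)
    (hab : a + b = 1) (h : binEnt q = a * binEnt q₁ + b * binEnt q₂) :
    binEnt (starOp q p) ≤ a * binEnt (starOp q₁ p) + b * binEnt (starOp q₂ p) := by
  have hl : 0 < log 2 := log_pos one_lt_two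
  have hI : ∀ u ∈ Icc (0 : ℝ) (1 / 2), 1 - 2 * u ∈ Icc (0 : ℝ) 1 := fun u hu ↦
    ⟨by linarith [hu.2], by linarith [hu.1]⟩
  have hsub : ∀ u : ℝ, (1 - (1 - 2 * u)) / 2 = u := fun u ↦ by ring
  have hstar : ∀ u : ℝ, (1 - (1 - 2 * p) * (1 - 2 * u)) / 2 = starOp u p := fun u ↦ by
    unfold starOp; ring
  simp only [binEnt_eq_binEntropy_div] at h ⊢
  have h' : binEntropy q = a * binEntropy q₁ + b * binEntropy q₂ := by
    field_simp at h
    exact h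
  have key := mrs_gerber (hI p hp) (hI q₁ hq₁) (hI q₂ hq₂) (hI q hq) ha hb hab
    (by simpa only [hsub] using h')
  simp only [hstar] at key
  rw [← mul_div_assoc, ← mul_div_assoc, ← add_div]
  exact div_le_div_of_nonneg_right key hl.le

open Real Set in
lemma exists_binEnt_eq_combination {q₁ q₂ a b : ℝ} (hq₁ : q₁ ∈ Icc 0 (1 / 2))
    (hq₂ : q₂ ∈ Icc 0 (1 / 2)) (ha : 0 ≤ a) (hb : 0 ≤ b) (hab : a + b = 1) :
    ∃ q ∈ Icc (0 : ℝ) (1 / 2), binEnt q = a * binEnt q₁ + b * binEnt q₂ := by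
  have hcont : Continuous binEnt := by
    rw [funext binEnt_eq_binEntropy_div]
    fun_prop
  have hconn : (binEnt '' Icc 0 (1 / 2)).OrdConnected :=
    (isPreconnected_Icc.image _ hcont.continuousOn).ordConnected
  exact hconn.convex (𝕜 := ℝ) (mem_image_of_mem _ hq₁) (mem_image_of_mem _ hq₂) ha hb hab

/-- For every fixed `p_A ∈ [0, 1/2]`, the binary key-leakage-storage region
`ℛ_{gs,bin}` of the generated-secret model is a convex subset of `ℝ³`. -/
theorem RgsBin_convex (pA : ℝ) (hpA : pA ∈ Set.Icc (0 : ℝ) (1 / 2)) :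
    Convex ℝ (RgsBin pA) := by
  rw [convex_iff_forall_pos]
  intro v hv w hw a b ha hb hab
  simp only [RgsBin, Set.mem_iUnion, Set.mem_ofPred_eq, exists_prop] at hv hw ⊢
  obtain ⟨q₁, hq₁, hv₀, hv₁, hv₂, hv₃⟩ := hv
  obtain ⟨q₂, hq₂, hw₀, hw₁, hw₂, hw₃⟩ := hw
  obtain ⟨q, hq, h⟩ := exists_binEnt_eq_combination hq₁ hq₂ ha.le hb.le hab
  have key := binEnt_starOp_le hpA hq hq₁ hq₂ ha hb hab h
  simp only [Prod.fst_add, Prod.snd_add, Prod.smul_fst, Prod.smul_snd, smul_eq_mul]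
  refine ⟨q, hq, by positivity, ?_, ?_, ?_⟩ <;> nlinarith
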